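/- For every real α ∈ (0,1) and every c > 0 there exist a constant C > 0 and an integer N₀ such that the following holds for all N ≥ N₀: if A ⊆ [N] is a subset with Σ_{p ≤ N^α} (log p / p) · (|A mod p| / p) < (α − c) · Σ_{p ≤ N^α} (log p / p), where the sums run over primes p ≤ N^α, then |A| ≤ C · N^α. -/

import Mathlib

/-- `A` reduced modulo `p`. -/
def modImage (A : Finset ℕ) (p : ℕ) : Finset (ZMod p) :=
  A.image (fun a => (Nat.cast a : ZMod p))

/-- The primes `p ≤ P` (for a real bound `P ≥ 0`). -/
noncomputable def primesUpTo (P : ℝ) : Finset ℕ :=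
  (Finset.range (⌊P⌋₊ + 1)).filter Nat.Prime

theorem sum_log_primes_dvd_le_log {S : Finset ℕ} (hS : ∀ p ∈ S, p.Prime) {d : ℕ} (hd : d ≠ 0) :
    ∑ p ∈ S with p ∣ d, Real.log p ≤ Real.log d := by
  have hdvd : ∏ p ∈ S with p ∣ d, p ∣ d :=
    Finset.prod_primes_dvd d (fun p hp => (hS p (Finset.mem_filter.1 hp).1).prime)
      (fun p hp => (Finset.mem_filter.1 hp).2)
  have hne : ∀ p ∈ S.filter (· ∣ d), (p : ℝ) ≠ 0 := fun p hp =>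
    Nat.cast_ne_zero.2 (hS p (Finset.mem_filter.1 hp).1).ne_zero
  rw [← Real.log_prod hne, ← Nat.cast_prod]
  refine Real.log_le_log ?_ (Nat.cast_le.2 (Nat.le_of_dvd (Nat.pos_of_ne_zero hd) hdvd))
  exact Nat.cast_pos.2 (Nat.pos_of_dvd_of_pos hdvd (Nat.pos_of_ne_zero hd))

theorem sum_log_primes_modEq_le_log {S : Finset ℕ} (hS : ∀ p ∈ S, p.Prime) {N a b : ℕ}
    (ha : a ∈ Finset.Icc 1 N) (hb : b ∈ Finset.Icc 1 N) (hab : a ≠ b) :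
    ∑ p ∈ S with (a : ZMod p) = (b : ZMod p), Real.log p ≤ Real.log N := by
  wlog h : a < b generalizing a b
  · simpa only [eq_comm] using this hb ha hab.symm (by omega)
  rw [Finset.mem_Icc] at ha hb
  have hfilter : S.filter (fun p => (a : ZMod p) = (b : ZMod p)) = S.filter (· ∣ b - a) :=
    Finset.filter_congr fun p _ => by
      rw [ZMod.natCast_eq_natCast_iff, Nat.modEq_iff_dvd' h.le]
  rw [hfilter]
  refine (sum_log_primes_dvd_le_log hS (by omega)).trans (Real.log_le_log ?_ ?_)
  · exact Nat.cast_pos.2 (by omega)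
  · exact Nat.cast_le.2 (by omega)

theorem card_sq_le_card_modImage_mul (A : Finset ℕ) (p : ℕ) :
    (A.card : ℝ) ^ 2 ≤ (modImage A p).card *
      ∑ a ∈ A, ∑ b ∈ A, if (a : ZMod p) = (b : ZMod p) then (1 : ℝ) else 0 := by
  have hmap : ∀ a ∈ A, (a : ZMod p) ∈ modImage A p := fun a ha =>
    Finset.mem_image_of_mem (fun a : ℕ => (a : ZMod p)) ha
  rw [Finset.card_eq_sum_card_fiberwise hmap, Nat.cast_sum]
  refine sq_sum_le_card_mul_sum_sq.trans_eq ?_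
  rw [← Finset.sum_fiberwise_of_maps_to hmap]
  congr 1
  refine Finset.sum_congr rfl fun r _ => ?_
  rw [Finset.sum_congr rfl (g := fun _ => ((A.filter fun b : ℕ => (b : ZMod p) = r).card : ℝ))]
  · rw [Finset.sum_const, nsmul_eq_mul, sq]
  · intro a ha
    rw [Finset.sum_boole, (Finset.mem_filter.1 ha).2]
    simp only [eq_comm]

/-- Gallagher's larger sieve. -/
theorem gallagher_larger_sieve {S : Finset ℕ} (hS : ∀ p ∈ S, p.Prime) {N : ℕ} {A : Finset ℕ}
    (hA : A ⊆ Finset.Icc 1 N) (hne : A.Nonempty) :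
    A.card * (∑ p ∈ S, Real.log p / (modImage A p).card - Real.log N) ≤
      ∑ p ∈ S, Real.log p := by
  have hk : (0 : ℝ) < A.card := Nat.cast_pos.2 hne.card_pos
  have hlog : ∀ p : ℕ, 0 ≤ Real.log p := fun p => Real.log_natCast_nonneg p
  have hlower : (A.card : ℝ) ^ 2 * ∑ p ∈ S, Real.log p / (modImage A p).card ≤
      ∑ p ∈ S, ∑ a ∈ A, ∑ b ∈ A,
        if (a : ZMod p) = (b : ZMod p) then Real.log p else 0 := by
    rw [Finset.mul_sum]
    refine Finset.sum_le_sum fun p _ => ?_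
    have hpos : (0 : ℝ) < (modImage A p).card := Nat.cast_pos.2 (hne.image _).card_pos
    rw [mul_div_assoc', div_le_iff₀ hpos]
    have h := mul_le_mul_of_nonneg_left (card_sq_le_card_modImage_mul A p) (hlog p)
    have heq : (∑ a ∈ A, ∑ b ∈ A, if (a : ZMod p) = (b : ZMod p) then Real.log p else 0) =
        Real.log p * ∑ a ∈ A, ∑ b ∈ A, if (a : ZMod p) = (b : ZMod p) then (1 : ℝ) else 0 := by
      simp only [Finset.mul_sum, mul_ite, mul_one, mul_zero]
    rw [heq]
    linarith
  have hupper : (∑ p ∈ S, ∑ a ∈ A, ∑ b ∈ A,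
        if (a : ZMod p) = (b : ZMod p) then Real.log p else 0) ≤
      ∑ a ∈ A, ∑ b ∈ A, ((if a = b then ∑ p ∈ S, Real.log p else 0) + Real.log N) := by
    rw [Finset.sum_comm]
    refine Finset.sum_le_sum fun a ha => ?_
    rw [Finset.sum_comm]
    refine Finset.sum_le_sum fun b hb => ?_
    rw [← Finset.sum_filter]
    split_ifs with hab
    · refine (Finset.sum_le_sum_of_subset_of_nonneg (Finset.filter_subset _ _)
        fun p _ _ => hlog p).trans (le_add_of_nonneg_right (hlog N))
    · rw [zero_add]
      exact sum_log_primes_modEq_le_log hS (hA ha) (hA hb) hab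
  have hsum : (∑ a ∈ A, ∑ b ∈ A, ((if a = b then ∑ p ∈ S, Real.log p else 0) + Real.log N)) =
      A.card * ∑ p ∈ S, Real.log p + (A.card : ℝ) ^ 2 * Real.log N := by
    simp only [Finset.sum_add_distrib, Finset.sum_ite_eq, Finset.sum_ite_mem, Finset.inter_self,
      Finset.sum_const, nsmul_eq_mul]
    ring
  refine le_of_mul_le_mul_left ?_ hk
  linarith [hlower.trans (hupper.trans_eq hsum)]

theorem summable_log_div_mul_sub_one :
    Summable fun n : ℕ => Real.log n / (n * ((n : ℝ) - 1)) := by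
  have hs : Summable fun n : ℕ => 4 * (n : ℝ) ^ (-(3 / 2) : ℝ) :=
    (Real.summable_nat_rpow.2 (by norm_num)).mul_left 4
  refine Summable.of_nonneg_of_le (fun n => ?_) (fun n => ?_) hs
  · rcases Nat.eq_zero_or_pos n with rfl | hn
    · simp
    · have : (1 : ℝ) ≤ n := Nat.one_le_cast.2 hn
      exact div_nonneg (Real.log_natCast_nonneg n) (mul_nonneg (by linarith) (by linarith))
  · rcases Nat.lt_or_ge n 2 with hn | hn
    · interval_cases n <;> norm_num
    · have h2 : (2 : ℝ) ≤ n := by exact_mod_cast hn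
      have h0 : (0 : ℝ) < n := by linarith
      have hlog := Real.log_le_rpow_div h0.le (ε := 1 / 2) (by norm_num)
      rw [div_le_iff₀ (mul_pos h0 (by linarith))]
      have hsplit : (n : ℝ) ^ (-(3 / 2) : ℝ) * (n * n) = (n : ℝ) ^ (1 / 2 : ℝ) := by
        rw [← sq, ← Real.rpow_natCast (n : ℝ) 2, ← Real.rpow_add h0]
        norm_num
      have hpos : 0 < (n : ℝ) ^ (-(3 / 2) : ℝ) := Real.rpow_pos_of_pos h0 _
      have hmul : (n : ℝ) * n ≤ 2 * (n * ((n : ℝ) - 1)) := by nlinarith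
      have := mul_le_mul_of_nonneg_left hmul hpos.le
      linarith

/-- The lower bound in Mertens' first theorem. -/
theorem exists_log_sub_le_sum_log_div_prime :
    ∃ K : ℝ, ∀ n : ℕ, 0 < n →
      Real.log n - K ≤ ∑ p ∈ (Finset.range (n + 1)).filter Nat.Prime, Real.log p / p := by
  refine ⟨1 + ∑' n : ℕ, Real.log n / (n * ((n : ℝ) - 1)), fun n hn => ?_⟩
  set S := (Finset.range (n + 1)).filter Nat.Prime
  have hn0 : (0 : ℝ) < n := Nat.cast_pos.2 hn
  have hprod : (n.factorial : ℝ) = ∏ p ∈ S, (p : ℝ) ^ padicValNat p n.factorial := by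
    have hsub : S ⊆ (Finset.range (n.factorial + 1)).filter Nat.Prime :=
      Finset.filter_subset_filter _
        (Finset.range_subset_range.2 (Nat.succ_le_succ n.self_le_factorial))
    conv_lhs => rw [← Nat.prod_pow_prime_padicValNat n.factorial n.factorial_ne_zero
      (n.factorial + 1) (Nat.lt_succ_self _)]
    push_cast
    refine (Finset.prod_subset hsub fun p hp hpS => ?_).symm
    have hpp : p.Prime := (Finset.mem_filter.1 hp).2
    have hlt : ¬ p ≤ n := fun h =>
      hpS (Finset.mem_filter.2 ⟨Finset.mem_range.2 (Nat.lt_succ_of_le h), hpp⟩)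
    rw [padicValNat.eq_zero_of_not_dvd (mt hpp.dvd_factorial.1 hlt), pow_zero]
  have hfact : Real.log n.factorial ≤ ∑ p ∈ S, n * (Real.log p / (p - 1)) := by
    rw [hprod, Real.log_prod]
    · refine Finset.sum_le_sum fun p hp => ?_
      have hpp : p.Prime := (Finset.mem_filter.1 hp).2
      have : Fact p.Prime := ⟨hpp⟩
      have h1 : (1 : ℝ) < p := Nat.one_lt_cast.2 hpp.one_lt
      have hval : ((p : ℝ) - 1) * padicValNat p n.factorial ≤ n := by
        have h := sub_one_mul_padicValNat_factorial (p := p) n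
        have h' : (p - 1) * padicValNat p n.factorial ≤ n := h ▸ Nat.sub_le _ _
        rw [← Nat.cast_one, ← Nat.cast_sub hpp.one_le]
        exact_mod_cast h'
      rw [Real.log_pow, mul_div_assoc', le_div_iff₀ (by linarith)]
      nlinarith [mul_le_mul_of_nonneg_right hval (Real.log_natCast_nonneg p)]
    · intro p hp
      exact pow_ne_zero _ (Nat.cast_ne_zero.2 (Finset.mem_filter.1 hp).2.ne_zero)
  have hstirling : n * Real.log n - n ≤ Real.log n.factorial := by
    have h := Stirling.le_log_factorial_stirling hn.ne'
    have hpi : 0 ≤ Real.log (2 * Real.pi) := Real.log_nonneg (by linarith [Real.pi_gt_three])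
    linarith [Real.log_natCast_nonneg n]
  have hsplit : ∑ p ∈ S, Real.log p / ((p : ℝ) - 1) =
      ∑ p ∈ S, Real.log p / p + ∑ p ∈ S, Real.log p / (p * ((p : ℝ) - 1)) := by
    rw [← Finset.sum_add_distrib]
    refine Finset.sum_congr rfl fun p hp => ?_
    have h1 : (1 : ℝ) < p := Nat.one_lt_cast.2 (Finset.mem_filter.1 hp).2.one_lt
    have h2 : (p : ℝ) - 1 ≠ 0 := by linarith
    have h3 : (p : ℝ) ≠ 0 := by linarith
    field_simp
    ring
  have htail : ∑ p ∈ S, Real.log p / (p * ((p : ℝ) - 1)) ≤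
      ∑' n : ℕ, Real.log n / (n * ((n : ℝ) - 1)) := by
    refine summable_log_div_mul_sub_one.sum_le_tsum S fun m _ => ?_
    rcases Nat.eq_zero_or_pos m with rfl | hm
    · simp
    · have : (1 : ℝ) ≤ m := Nat.one_le_cast.2 hm
      exact div_nonneg (Real.log_natCast_nonneg m) (mul_nonneg (by linarith) (by linarith))
  rw [← Finset.mul_sum] at hfact
  have hfinal : n * (Real.log n - 1) ≤ n * ∑ p ∈ S, Real.log p / ((p : ℝ) - 1) := by linarith
  have := le_of_mul_le_mul_left hfinal hn0
  linarith

theorem larger_sieve_density_form (α : ℝ) (hα0 : 0 < α) (hα1 : α < 1)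
    (c : ℝ) (hc : 0 < c) :
    ∃ C : ℝ, C > 0 ∧ ∃ N₀ : ℕ, ∀ N : ℕ, N ≥ N₀ →
      ∀ A : Finset ℕ, A ⊆ Finset.Icc 1 N →
        (∑ p ∈ primesUpTo ((N : ℝ) ^ α),
            (Real.log p / p) * (((modImage A p).card : ℝ) / p)) <
          (α - c) * ∑ p ∈ primesUpTo ((N : ℝ) ^ α), Real.log p / p →
        (A.card : ℝ) ≤ C * (N : ℝ) ^ α := by
  obtain ⟨K, hK⟩ := exists_log_sub_le_sum_log_div_prime
  have hlarge : ∀ᶠ N : ℕ in Filter.atTop, (K + Real.log 2 + α) / c ≤ Real.log N :=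
    (Real.tendsto_log_atTop.comp tendsto_natCast_atTop_atTop).eventually_ge_atTop _
  obtain ⟨N₀, hN₀⟩ := Filter.eventually_atTop.1 (hlarge.and (Filter.eventually_ge_atTop 1))
  refine ⟨Real.log 4, Real.log_pos (by norm_num), N₀, fun N hN A hA hlt => ?_⟩
  obtain ⟨hNlog, hN1⟩ := hN₀ N hN
  rw [div_le_iff₀ hc] at hNlog
  have hN1' : (1 : ℝ) ≤ N := Nat.one_le_cast.2 hN1
  have hP1 : 1 ≤ (N : ℝ) ^ α := Real.one_le_rpow hN1' hα0.le
  rcases A.eq_empty_or_nonempty with rfl | hne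
  · simp only [Finset.card_empty, Nat.cast_zero]
    exact mul_nonneg (Real.log_nonneg (by norm_num)) (by linarith)
  have hmertens : α * Real.log N - Real.log 2 - K ≤
      ∑ p ∈ primesUpTo ((N : ℝ) ^ α), Real.log p / p := by
    have hfloor : 0 < ⌊(N : ℝ) ^ α⌋₊ := Nat.floor_pos.2 hP1
    have hfl1 : (1 : ℝ) ≤ ⌊(N : ℝ) ^ α⌋₊ := Nat.one_le_cast.2 hfloor
    have hhalf : (N : ℝ) ^ α ≤ 2 * ⌊(N : ℝ) ^ α⌋₊ := by
      linarith [Nat.lt_floor_add_one ((N : ℝ) ^ α)]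
    have hlog := Real.log_le_log (by linarith) hhalf
    rw [Real.log_rpow (by linarith), Real.log_mul two_ne_zero (by linarith)] at hlog
    have := hK _ hfloor
    unfold primesUpTo
    linarith
  have htheta : ∑ p ∈ primesUpTo ((N : ℝ) ^ α), Real.log p ≤ Real.log 4 * (N : ℝ) ^ α := by
    have h := Chebyshev.theta_le_log4_mul_x (by linarith : 0 ≤ (N : ℝ) ^ α)
    rwa [Chebyshev.theta_eq_sum_Icc, ← Nat.range_succ_eq_Icc_zero] at h
  have hS : ∀ p ∈ primesUpTo ((N : ℝ) ^ α), p.Prime := fun p hp => (Finset.mem_filter.1 hp).2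
  set S := primesUpTo ((N : ℝ) ^ α)
  set W := ∑ p ∈ S, Real.log p / p
  have hW : 0 ≤ W := Finset.sum_nonneg fun p _ =>
    div_nonneg (Real.log_natCast_nonneg p) p.cast_nonneg
  set V := ∑ p ∈ S, (Real.log p / p) * (((modImage A p).card : ℝ) / p) with hVdef
  have hV : 0 ≤ V := Finset.sum_nonneg fun p _ => mul_nonneg
    (div_nonneg (Real.log_natCast_nonneg p) p.cast_nonneg) (by positivity)
  have hWpos : 0 < W := hW.lt_of_ne fun h => by
    rw [← h, mul_zero] at hlt
    exact hlt.not_ge hV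
  have hαc : 0 < α - c := pos_of_mul_pos_left (hV.trans_lt hlt) hW
  have hcs : W ^ 2 ≤ V * ∑ p ∈ S, Real.log p / (modImage A p).card := by
    refine Finset.sum_sq_le_sum_mul_sum_of_sq_le_mul S (fun p _ => ?_) (fun p _ => ?_)
      fun p hp => ?_
    · exact mul_nonneg (div_nonneg (Real.log_natCast_nonneg p) p.cast_nonneg) (by positivity)
    · exact div_nonneg (Real.log_natCast_nonneg p) (Nat.cast_nonneg _)
    · have h1 : (p : ℝ) ≠ 0 := Nat.cast_ne_zero.2 (hS p hp).ne_zero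
      have h2 : ((modImage A p).card : ℝ) ≠ 0 :=
        Nat.cast_ne_zero.2 (hne.image _).card_pos.ne'
      refine le_of_eq ?_
      field_simp
  set T := ∑ p ∈ S, Real.log p / (modImage A p).card
  have hT : 0 ≤ T := Finset.sum_nonneg fun p _ =>
    div_nonneg (Real.log_natCast_nonneg p) (Nat.cast_nonneg _)
  have hWT : W ≤ (α - c) * T := by
    refine le_of_mul_le_mul_left ?_ hWpos
    nlinarith [mul_le_mul_of_nonneg_right hlt.le hT]
  have hgap : 1 ≤ T - Real.log N := by
    refine le_of_mul_le_mul_left ?_ hαc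
    linarith
  have hsieve := gallagher_larger_sieve hS hA hne
  have hk : (0 : ℝ) ≤ A.card := Nat.cast_nonneg _
  calc (A.card : ℝ) ≤ A.card * (T - Real.log N) := le_mul_of_one_le_right hk hgap
    _ ≤ _ := hsieve.trans htheta
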